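/- arXiv:2403.07239 — 6 statements merged into one kernel-verified Lean document; each statement's English description precedes it below -/
import Mathlib

section
/- Let V be a finite set, let p ≥ 0, k ≥ 1 and t ≥ 1 be integers, and let B₁, …, B_t be finite subsets of V such that: (i) every element of V belongs to some bag B_j; (ii) |B_j| ≤ p + 1 for every j; (iii) for every v ∈ V the set { j : v ∈ B_j } is an interval of consecutive indices; and (iv) for every j < t the symmetric difference of B_j and B_{j+1} contains at most one element. Then there exists a partition of V into k sets V₁, …, V_k such that for every j ∈ {1, …, t} and every i ∈ {1, …, k} one has |V_i ∩ B_j| ≤ ⌈(p+1)/k⌉. -/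
/-- Some colour class of a `k`-colouring has at most `m / k` elements in a set of size at most
`m`. -/
theorem exists_card_filter_le_div {α : Type*} {m k : ℕ} (hk : 1 ≤ k)
    (S : Finset α) (hS : S.card ≤ m) (c : α → Fin k) :
    ∃ x, (S.filter (c · = x)).card ≤ m / k := by
  by_contra! h
  have hsum : S.card = ∑ x, (S.filter (c · = x)).card :=
    Finset.card_eq_sum_card_fiberwise fun _ _ => Finset.mem_coe.2 (Finset.mem_univ _)
  have hle : ∑ _x : Fin k, (m / k + 1) ≤ ∑ x, (S.filter (c · = x)).card :=
    Finset.sum_le_sum fun x _ => h x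
  have hlt : m < k * (m / k + 1) := Nat.lt_mul_div_succ m hk
  simp only [Finset.sum_const, Finset.card_univ, Fintype.card_fin, smul_eq_mul] at hle
  omega

/-- Recolouring a point outside `S` does not change the colour classes in `S`. -/
theorem filter_update_eq_of_notMem {α β : Type*} [DecidableEq α] [DecidableEq β]
    {S : Finset α} {v : α} (hv : v ∉ S) (c : α → β) (x i : β) :
    S.filter (Function.update c v x · = i) = S.filter (c · = i) := by
  refine Finset.filter_congr fun a ha => ?_
  rw [Function.update_of_ne (ne_of_mem_of_not_mem ha hv)]

/-- A balanced colouring of `S` extends to a balanced colouring of `insert v S` by recolouring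
only `v`. -/
theorem exists_update_card_filter_le {α : Type*} [DecidableEq α] {m k : ℕ} (hk : 1 ≤ k)
    {S : Finset α} {v : α} (hS : S.card ≤ m) (hv : v ∉ S) (c : α → Fin k)
    (hc : ∀ i, (S.filter (c · = i)).card ≤ m / k + 1) :
    ∃ x, ∀ i, ((insert v S).filter (Function.update c v x · = i)).card ≤ m / k + 1 := by
  obtain ⟨x, hx⟩ := exists_card_filter_le_div hk S hS c
  refine ⟨x, fun i => ?_⟩
  rw [Finset.filter_insert, filter_update_eq_of_notMem hv, Function.update_self]
  split_ifs with h
  · subst h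
    exact (Finset.card_insert_le _ _).trans (Nat.succ_le_succ hx)
  · exact hc i

/-- Every set of size at most `m + 1` has a `k`-colouring with classes of size at most
`m / k + 1`. -/
theorem exists_balanced_coloring {α : Type*} [DecidableEq α] {m k : ℕ} (hk : 1 ≤ k)
    (S : Finset α) (hS : S.card ≤ m + 1) :
    ∃ c : α → Fin k, ∀ i, (S.filter (c · = i)).card ≤ m / k + 1 := by
  induction S using Finset.induction_on with
  | empty => exact ⟨fun _ => ⟨0, hk⟩, by simp⟩
  | insert v S hv ih =>
    rw [Finset.card_insert_of_notMem hv] at hS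
    obtain ⟨c, hc⟩ := ih (by omega)
    obtain ⟨x, hx⟩ := exists_update_card_filter_le hk (Nat.le_of_succ_le_succ hS) hv c hc
    exact ⟨_, hx⟩

/-- If the symmetric difference of `S` and `T` has at most one element, then `T` is a subset of
`S` or arises from `S` by inserting one element. -/
theorem subset_or_eq_insert_of_card_sdiff_add_card_sdiff_le_one {α : Type*} [DecidableEq α]
    {S T : Finset α} (h : (S \ T).card + (T \ S).card ≤ 1) :
    T ⊆ S ∨ ∃ v ∉ S, T = insert v S := by
  rcases Nat.eq_zero_or_pos (T \ S).card with h0 | h0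
  · exact Or.inl (Finset.sdiff_eq_empty_iff_subset.1 (Finset.card_eq_zero.1 h0))
  · have hST : S ⊆ T :=
      Finset.sdiff_eq_empty_iff_subset.1 (Finset.card_eq_zero.1 (by omega))
    obtain ⟨v, hv⟩ := Finset.card_eq_one.1 (show (T \ S).card = 1 by omega)
    have hvm : v ∈ T \ S := hv ▸ Finset.mem_singleton_self v
    refine Or.inr ⟨v, (Finset.mem_sdiff.1 hvm).2, ?_⟩
    rw [Finset.insert_eq, ← hv, Finset.sdiff_union_of_subset hST]

theorem natCast_div_add_one_le_ceil {p k : ℕ} (hk : 1 ≤ k) :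
    ((p / k + 1 : ℕ) : ℤ) ≤ ⌈((p : ℚ) + 1) / (k : ℚ)⌉ := by
  have hk' : (0 : ℚ) < k := by exact_mod_cast hk
  rw [Nat.cast_add_one, Int.add_one_le_iff, Int.lt_ceil, lt_div_iff₀ hk']
  exact_mod_cast Nat.lt_succ_of_le (Nat.div_mul_le_self p k)

/-- Given a nice path decomposition `B₁, …, B_t` of width `p` of a graph on
vertex set `V` (conditions (i)–(iv)), and any `k ≥ 1`, the vertex set `V` can be partitioned
into `k` sets `V₁, …, V_k` such that every part meets every bag in at most `⌈(p+1)/k⌉`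
elements. -/
theorem stmt0 {α : Type*} [DecidableEq α] (V : Finset α) (p k t : ℕ)
    (hk : 1 ≤ k) (ht : 1 ≤ t) (B : Fin t → Finset α)
    (hsub : ∀ j, B j ⊆ V)
    (hcover : ∀ v ∈ V, ∃ j, v ∈ B j)
    (hwidth : ∀ j, (B j).card ≤ p + 1)
    (hinterval : ∀ v : α, ∀ i j l : Fin t, i ≤ j → j ≤ l →
      v ∈ B i → v ∈ B l → v ∈ B j)
    (hnice : ∀ (j : ℕ) (hj : j + 1 < t),
      (B ⟨j, by omega⟩ \ B ⟨j + 1, hj⟩).card +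
        (B ⟨j + 1, hj⟩ \ B ⟨j, by omega⟩).card ≤ 1) :
    ∃ P : Fin k → Finset α,
      (∀ i, P i ⊆ V) ∧
      (∀ i i', i ≠ i' → Disjoint (P i) (P i')) ∧
      (Finset.univ.biUnion P = V) ∧
      (∀ (j : Fin t) (i : Fin k),
        ((P i ∩ B j).card : ℤ) ≤ ⌈((p : ℚ) + 1) / (k : ℚ)⌉) := by
  have key : ∀ n, n < t → ∃ c : α → Fin k, ∀ j : Fin t, j.val ≤ n →
      ∀ i, ((B j).filter (c · = i)).card ≤ p / k + 1 := by
    intro n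
    induction n with
    | zero =>
      intro hn
      obtain ⟨c, hc⟩ := exists_balanced_coloring hk (B ⟨0, hn⟩) (hwidth _)
      refine ⟨c, fun j hj => ?_⟩
      obtain rfl : j = ⟨0, hn⟩ := Fin.ext (Nat.le_zero.1 hj)
      exact hc
    | succ n ih =>
      intro hn
      obtain ⟨c, hc⟩ := ih (by omega)
      rcases subset_or_eq_insert_of_card_sdiff_add_card_sdiff_le_one (hnice n hn) with
        h | ⟨v, hv, h⟩
      · refine ⟨c, fun j hj i => ?_⟩
        rcases Nat.le_succ_iff.1 hj with hj | hj
        · exact hc j hj i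
        · obtain rfl : j = ⟨n + 1, hn⟩ := Fin.ext hj
          exact (Finset.card_le_card (Finset.filter_subset_filter _ h)).trans
            (hc ⟨n, by omega⟩ le_rfl i)
      · have hcard := hwidth ⟨n + 1, hn⟩
        rw [h, Finset.card_insert_of_notMem hv] at hcard
        obtain ⟨x, hx⟩ := exists_update_card_filter_le hk (Nat.le_of_succ_le_succ hcard) hv c
          (hc ⟨n, by omega⟩ le_rfl)
        refine ⟨Function.update c v x, fun j hj i => ?_⟩
        rcases Nat.le_succ_iff.1 hj with hj | hj
        · have hvj : v ∉ B j := fun hvj => hv <|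
            hinterval v j ⟨n, by omega⟩ ⟨n + 1, hn⟩ hj (Nat.le_succ n) hvj
              (h ▸ Finset.mem_insert_self v _)
          rw [filter_update_eq_of_notMem hvj]
          exact hc j hj i
        · obtain rfl : j = ⟨n + 1, hn⟩ := Fin.ext hj
          rw [h]
          exact hx i
  obtain ⟨c, hc⟩ := key (t - 1) (by omega)
  refine ⟨fun i => V.filter (c · = i), fun i => Finset.filter_subset _ _, fun i i' hi => ?_,
    ?_, fun j i => ?_⟩
  · exact Finset.disjoint_filter.2 fun a _ h h' => hi (h.symm.trans h')
  · ext a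
    simp
  · rw [Finset.filter_inter, Finset.inter_eq_right.2 (hsub j)]
    exact (Int.ofNat_le.2 (hc j (by omega) i)).trans (natCast_div_add_one_le_ceil hk)
end

section
/- For every integer r ≥ 1 there exists a 3-CNF formula φ over a set of variables consisting of 2r input variables x₁, …, x_r, y₁, …, y_r together with at most 2r + 1 additional variables, such that for every Boolean assignment σ of the input variables the following are equivalent: (a) σ can be extended to a Boolean assignment of all the variables of φ that satisfies φ; (b) Σ_{i=1}^{r} σ(x_i)·2^{i−1} = Σ_{i=1}^{r} σ(y_i)·2^{i−1} + 1, where the Boolean value true is read as 1 and false as 0. -/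
open scoped Classical

namespace PPSETH

abbrev Var := ℕ
abbrev Clause := Finset (Var × Bool)
abbrev CNF := List Clause

/-- The set of variables occurring in a clause. -/
def clauseVars (c : Clause) : Finset Var := c.image Prod.fst

/-- The set of variables occurring in a CNF formula. -/
def cnfVars (φ : CNF) : Finset Var := φ.foldr (fun c s => clauseVars c ∪ s) ∅

/-- An assignment satisfies a clause if the clause contains a literal it makes true. -/
def SatC (τ : Var → Bool) (c : Clause) : Prop := ∃ l ∈ c, τ l.1 = l.2

/-- An assignment satisfies a CNF formula if it satisfies every clause. -/
def Sat (τ : Var → Bool) (φ : CNF) : Prop := ∀ c ∈ φ, SatC τ c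

def Satisfiable (φ : CNF) : Prop := ∃ τ, Sat τ φ

/-- Size of a CNF formula: number of variables plus total number of literal occurrences. -/
def size (φ : CNF) : ℕ := (cnfVars φ).card + (φ.map Finset.card).sum

/-- Weight of an assignment: the number of variables of the formula set to true. -/
def weight (φ : CNF) (τ : Var → Bool) : ℕ :=
  ((cnfVars φ).filter (fun x => τ x = true)).card

/-- The number of clauses (with multiplicity) satisfied by an assignment. -/
noncomputable def satCount (φ : CNF) (τ : Var → Bool) : ℕ :=
  (φ.map (fun c => if SatC τ c then 1 else 0)).sum

/-- Number of clauses (with multiplicity) in which a variable occurs. -/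
noncomputable def occs (φ : CNF) (x : Var) : ℕ :=
  (φ.map (fun c => if x ∈ clauseVars c then 1 else 0)).sum

/-- A k-CNF formula: every clause has at most k literals. -/
def IsKCNF (k : ℕ) (φ : CNF) : Prop := ∀ c ∈ φ, c.card ≤ k

/-- Structural conditions for a path decomposition of (the primal graph of) a CNF formula. -/
def PDOn (φ : CNF) (B : List (Finset Var)) : Prop :=
  (∀ b ∈ B, b ⊆ cnfVars φ) ∧
  (∀ x ∈ cnfVars φ, ∃ b ∈ B, x ∈ b) ∧
  (∀ c ∈ φ, ∃ b ∈ B, clauseVars c ⊆ b) ∧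
  (∀ x : Var, ∀ i j k : ℕ, i ≤ j → j ≤ k →
    x ∈ B.getD i ∅ → x ∈ B.getD k ∅ → x ∈ B.getD j ∅)

/-- A path decomposition of a CNF formula of width `p`: bags have size at most `p + 1`. -/
def PD (φ : CNF) (p : ℕ) (B : List (Finset Var)) : Prop :=
  PDOn φ B ∧ ∀ b ∈ B, b.card ≤ p + 1

/-- The carry into position `i` when one is added to the binary number with digits `y`. -/
def carry (y : ℕ → Bool) : ℕ → Bool
  | 0 => true
  | i + 1 => y i && carry y i

/-- The value of the binary number formed by the first `n` digits of `x`. -/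
def binValue (x : ℕ → Bool) (n : ℕ) : ℕ := ∑ i ∈ Finset.range n, if x i then 2 ^ i else 0

lemma binValue_succ (x : ℕ → Bool) (n : ℕ) :
    binValue x (n + 1) = binValue x n + if x n then 2 ^ n else 0 :=
  Finset.sum_range_succ _ _

lemma binValue_lt (x : ℕ → Bool) (n : ℕ) : binValue x n < 2 ^ n := by
  induction n with
  | zero => simp [binValue]
  | succ n ih =>
    rw [binValue_succ, pow_succ]
    split_ifs <;> omega

lemma binValue_add_carry_iff (x y : ℕ → Bool) (n : ℕ) (b : Bool) :
    binValue x n + (if b then 2 ^ n else 0) = binValue y n + 1 ↔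
      carry y n = b ∧ ∀ i < n, x i = (y i ^^ carry y i) := by
  induction n generalizing b with
  | zero => cases b <;> simp [binValue, carry]
  | succ n ih =>
    have hx := binValue_lt x n
    have hy := binValue_lt y n
    have h₀ := ih false
    have h₁ := ih true
    rw [Nat.forall_lt_succ_right, binValue_succ, binValue_succ, pow_succ, carry]
    generalize (∀ i < n, x i = (y i ^^ carry y i)) = p at *
    generalize binValue x n = u at *
    generalize binValue y n = v at *
    generalize 2 ^ n = w at *
    generalize carry y n = c at *
    generalize x n = s
    generalize y n = t
    cases b <;> cases c <;> cases s <;> cases t <;> simp at * <;>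
      first
        | omega
        | (by_cases hp : p <;> simp [hp] at * <;> omega)

/-- Clauses for a half adder on inputs `y`, `c` with sum bit `x` and carry bit `d`. -/
def halfAdder (x y c d : Var) : CNF :=
  [{(x, false), (y, true), (c, true)}, {(x, false), (y, false), (c, false)},
    {(x, true), (y, false), (c, true)}, {(x, true), (y, true), (c, false)},
    {(d, false), (y, true)}, {(d, false), (c, true)}, {(d, true), (y, false), (c, false)}]

lemma sat_halfAdder_iff (τ : Var → Bool) (x y c d : Var) :
    Sat τ (halfAdder x y c d) ↔ τ x = (τ y ^^ τ c) ∧ τ d = (τ y && τ c) := by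
  simp only [Sat, SatC, halfAdder, List.forall_mem_cons, Finset.exists_mem_insert,
    Finset.mem_singleton, exists_eq_left, List.not_mem_nil, false_imp_iff, implies_true, and_true]
  cases τ x <;> cases τ y <;> cases τ c <;> cases τ d <;> simp

lemma isKCNF_halfAdder (x y c d : Var) : IsKCNF 3 (halfAdder x y c d) := by
  simp only [IsKCNF, halfAdder, List.forall_mem_cons, List.not_mem_nil, false_imp_iff,
    implies_true, and_true]
  exact ⟨Finset.card_le_three, Finset.card_le_three, Finset.card_le_three, Finset.card_le_three,
    Finset.card_le_two.trans (by simp), Finset.card_le_two.trans (by simp), Finset.card_le_three⟩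

lemma cnfVars_subset_iff (φ : CNF) (s : Finset Var) :
    cnfVars φ ⊆ s ↔ ∀ c ∈ φ, ∀ l ∈ c, l.1 ∈ s := by
  induction φ with
  | nil => simp [cnfVars]
  | cons c φ ih =>
    rw [List.forall_mem_cons, ← ih]
    change clauseVars c ∪ cnfVars φ ⊆ s ↔ _
    rw [Finset.union_subset_iff, clauseVars, Finset.image_subset_iff]

/-- The formula asserting `x = y + 1` for two `r`-bit numbers, computed by a chain of half adders
whose carries are the variables `2 * r, …, 3 * r`. -/
def successorCNF (r : ℕ) : CNF :=
  {(2 * r, true)} :: {(2 * r + r, false)} ::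
    (List.range r).flatMap fun i => halfAdder i (r + i) (2 * r + i) (2 * r + (i + 1))

lemma isKCNF_successorCNF (r : ℕ) : IsKCNF 3 (successorCNF r) := by
  intro c hc
  simp only [successorCNF, List.mem_cons, List.mem_flatMap] at hc
  obtain rfl | rfl | ⟨i, -, hc⟩ := hc
  · simp
  · simp
  · exact isKCNF_halfAdder _ _ _ _ c hc

lemma cnfVars_successorCNF_subset (r : ℕ) :
    cnfVars (successorCNF r) ⊆ Finset.range (3 * r + 1) := by
  rw [cnfVars_subset_iff]
  intro c hc l hl
  simp only [successorCNF, List.mem_cons, List.mem_flatMap, List.mem_range] at hc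
  obtain rfl | rfl | ⟨i, hi, hc⟩ := hc
  · simp only [Finset.mem_singleton] at hl
    subst hl
    simp only [Finset.mem_range]
    omega
  · simp only [Finset.mem_singleton] at hl
    subst hl
    simp only [Finset.mem_range]
    omega
  · simp only [halfAdder, List.mem_cons, List.not_mem_nil, or_false] at hc
    rw [Finset.mem_range]
    rcases hc with rfl | rfl | rfl | rfl | rfl | rfl | rfl <;>
      simp only [Finset.mem_insert, Finset.mem_singleton] at hl <;>
      rcases hl with rfl | rfl | rfl <;> dsimp only <;> omega

lemma sat_successorCNF_iff (r : ℕ) (τ : Var → Bool) :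
    Sat τ (successorCNF r) ↔ τ (2 * r) = true ∧ τ (2 * r + r) = false ∧
      ∀ i < r, τ i = (τ (r + i) ^^ τ (2 * r + i)) ∧
        τ (2 * r + (i + 1)) = (τ (r + i) && τ (2 * r + i)) := by
  simp only [← sat_halfAdder_iff]
  simp only [successorCNF, Sat, List.forall_mem_cons, List.mem_flatMap, List.mem_range, SatC,
    Finset.mem_singleton, exists_eq_left]
  exact and_congr_right' <| and_congr_right'
    ⟨fun h i hi c hc => h c ⟨i, hi, hc⟩, fun h c ⟨i, hi, hc⟩ => h i hi c hc⟩

/-- For every `r ≥ 1` there is a 3-CNF formula over the `2r` input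
variables `0, …, 2r − 1` (variable `i − 1` playing the role of `xᵢ` and variable
`r + i − 1` that of `yᵢ`) plus at most `2r + 1` additional variables, such that an
assignment `σ` of the input variables extends to a satisfying assignment of the formula
iff the number encoded in binary by the `x` variables equals the number encoded by the
`y` variables plus one. -/
theorem stmt1 (r : ℕ) (hr : 1 ≤ r) :
    ∃ φ : CNF, IsKCNF 3 φ ∧
      (cnfVars φ \ Finset.range (2 * r)).card ≤ 2 * r + 1 ∧
      ∀ σ : Var → Bool,
        ((∃ τ : Var → Bool, (∀ i < 2 * r, τ i = σ i) ∧ Sat τ φ) ↔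
          (∑ i ∈ Finset.range r, (if σ i then 2 ^ i else 0)) =
            (∑ i ∈ Finset.range r, (if σ (r + i) then 2 ^ i else 0)) + 1) := by
  refine ⟨successorCNF r, isKCNF_successorCNF r, ?_, fun σ => ?_⟩
  · calc (cnfVars (successorCNF r) \ Finset.range (2 * r)).card
        ≤ (Finset.range (3 * r + 1) \ Finset.range (2 * r)).card :=
          Finset.card_le_card (Finset.sdiff_subset_sdiff (cnfVars_successorCNF_subset r) le_rfl)
      _ = 3 * r + 1 - 2 * r := by
          rw [Finset.card_sdiff_of_subset (Finset.range_subset_range.2 (by omega)),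
            Finset.card_range, Finset.card_range]
      _ ≤ 2 * r + 1 := by omega
  · have key := binValue_add_carry_iff σ (fun i => σ (r + i)) r false
    simp only [Bool.false_eq_true, if_false, add_zero] at key
    refine Iff.trans ?_ key.symm
    simp only [sat_successorCNF_iff]
    constructor
    · rintro ⟨τ, hτ, h₀, hlast, hstep⟩
      have hc : ∀ i ≤ r, τ (2 * r + i) = carry (fun i => σ (r + i)) i := by
        intro i hi
        induction i with
        | zero => exact h₀
        | succ i ih =>
          rw [(hstep i hi).2, carry, ih (by omega), hτ (r + i) (by omega)]
      refine ⟨(hc r le_rfl).symm.trans hlast, fun i hi => ?_⟩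
      rw [← hτ i (by omega), ← hτ (r + i) (by omega), ← hc i hi.le]
      exact (hstep i hi).1
    · rintro ⟨hlast, hstep⟩
      set τ : Var → Bool := fun v =>
        if v < 2 * r then σ v else carry (fun i => σ (r + i)) (v - 2 * r) with hτ
      have hin : ∀ i < 2 * r, τ i = σ i := fun i hi => if_pos hi
      have hc : ∀ i, τ (2 * r + i) = carry (fun i => σ (r + i)) i := fun i => by simp [hτ]
      refine ⟨τ, hin, hc 0, (hc r).trans hlast, fun i hi => ?_⟩
      rw [hc, hc, hin i (by omega), hin (r + i) (by omega)]
      exact ⟨hstep i hi, rfl⟩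

end PPSETH
end

section
/- Let G be a simple graph and let u, v, x₁, x₂, x₃, x₄ be six pairwise distinct vertices of G such that for each i ∈ {1, 2, 3, 4} the neighborhood of x_i in G is exactly {u, v}. If S is a C₄-hitting set of G with u ∉ S and v ∉ S, then the set S' = (S \ {x₁, x₂, x₃, x₄}) ∪ {u, v} is a C₄-hitting set of G with |S'| < |S|. In particular, every minimum-cardinality C₄-hitting set of G contains u or v. -/
/-- A set `S` of vertices is a C₄-hitting set of `G` if every 4-cycle (as a subgraph)
meets `S`. -/
def C4Hitting {V : Type*} (G : SimpleGraph V) (S : Set V) : Prop :=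
  ∀ a b c d : V, a ≠ b → a ≠ c → a ≠ d → b ≠ c → b ≠ d → c ≠ d →
    G.Adj a b → G.Adj b c → G.Adj c d → G.Adj d a →
    a ∈ S ∨ b ∈ S ∨ c ∈ S ∨ d ∈ S

/-- Trading a set `X` of vertices, all of whose neighbors lie in `N`, for `N` preserves the
C₄-hitting property. -/
theorem C4Hitting.sdiff_union {V : Type*} {G : SimpleGraph V} {S X N : Set V}
    (hS : C4Hitting G S) (hX : ∀ y ∈ X, G.neighborSet y ⊆ N) :
    C4Hitting G (S \ X ∪ N) := by
  have key : ∀ y z, G.Adj y z → y ∈ S → y ∈ S \ X ∪ N ∨ z ∈ S \ X ∪ N := by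
    intro y z hyz hy
    by_cases hyX : y ∈ X
    · exact .inr (.inr (hX y hyX hyz))
    · exact .inl (.inl ⟨hy, hyX⟩)
  intro a b c d hab hac had hbc hbd hcd eab ebc ecd eda
  rcases hS a b c d hab hac had hbc hbd hcd eab ebc ecd eda with h | h | h | h
  · have := key a b eab h
    tauto
  · have := key b c ebc h
    tauto
  · have := key c d ecd h
    tauto
  · have := key d a eda h
    tauto

/-- A C₄-hitting set avoiding `u` and `v` misses at most one common neighbor of `u` and `v`. -/
theorem C4Hitting.card_sdiff_le_one {V : Type*} [DecidableEq V] {G : SimpleGraph V} {u v : V}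
    {S X : Finset V} (huv : u ≠ v) (hS : C4Hitting G ↑S) (hu : u ∉ S) (hv : v ∉ S)
    (hX : ∀ y ∈ X, G.Adj y u ∧ G.Adj y v) : (X \ S).card ≤ 1 := by
  refine Finset.card_le_one.2 fun a ha b hb => ?_
  rw [Finset.mem_sdiff] at ha hb
  by_contra hab
  obtain ⟨hau, hav⟩ := hX a ha.1
  obtain ⟨hbu, hbv⟩ := hX b hb.1
  have := hS u a v b hau.ne' huv hbu.ne' hav.ne hab hbv.ne' hau.symm hav hbv.symm hbu
  simp only [Finset.mem_coe] at this
  tauto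

/-- A C₄-hitting set avoiding `u` and `v` shrinks when at least four common neighbors of `u` and
`v` are traded for `u` and `v`. -/
theorem C4Hitting.card_sdiff_union_lt {V : Type*} [DecidableEq V] {G : SimpleGraph V} {u v : V}
    {S X : Finset V} (huv : u ≠ v) (hS : C4Hitting G ↑S) (hu : u ∉ S) (hv : v ∉ S)
    (hX : ∀ y ∈ X, G.Adj y u ∧ G.Adj y v) (hcard : 4 ≤ X.card) :
    (S \ X ∪ {u, v}).card < S.card := by
  have h₁ := hS.card_sdiff_le_one huv hu hv hX
  have h₂ := Finset.card_sdiff_add_card_inter X S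
  have h₃ := Finset.card_sdiff_add_card_inter S X
  rw [Finset.inter_comm] at h₃
  have h₄ := Finset.card_union_le (S \ X) {u, v}
  have h₅ := Finset.card_le_two (a := u) (b := v)
  omega

/-- If `u, v, x₁, x₂, x₃, x₄` are pairwise distinct vertices such that the
neighborhood of each `xᵢ` is exactly `{u, v}`, and `S` is a C₄-hitting set with `u ∉ S` and
`v ∉ S`, then `S' = (S \ {x₁, x₂, x₃, x₄}) ∪ {u, v}` is a C₄-hitting set with `|S'| < |S|`.
In particular, every minimum-cardinality C₄-hitting set contains `u` or `v`. -/
theorem stmt4 {V : Type*} [DecidableEq V] (G : SimpleGraph V) (u v : V) (x : Fin 4 → V)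
    (huv : u ≠ v) (hinj : Function.Injective x)
    (hxu : ∀ i, x i ≠ u) (hxv : ∀ i, x i ≠ v)
    (hnbhd : ∀ i, G.neighborSet (x i) = {u, v})
    (S : Finset V) (hS : C4Hitting G ↑S) (hu : u ∉ S) (hv : v ∉ S) :
    (C4Hitting G ↑((S \ {x 0, x 1, x 2, x 3}) ∪ {u, v}) ∧
      ((S \ {x 0, x 1, x 2, x 3}) ∪ {u, v}).card < S.card) ∧
    ∀ M : Finset V, C4Hitting G ↑M →
      (∀ T : Finset V, C4Hitting G ↑T → M.card ≤ T.card) → u ∈ M ∨ v ∈ M := by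
  have hX : ∀ y ∈ ({x 0, x 1, x 2, x 3} : Finset V), G.neighborSet y = {u, v} := by
    simp [hnbhd]
  have hadj : ∀ y ∈ ({x 0, x 1, x 2, x 3} : Finset V), G.Adj y u ∧ G.Adj y v := by
    intro y hy
    simp [← SimpleGraph.mem_neighborSet, hX y hy]
  have hcard : 4 ≤ ({x 0, x 1, x 2, x 3} : Finset V).card := by
    simp [Finset.card_insert_of_notMem, hinj.eq_iff]
  have main : ∀ T : Finset V, C4Hitting G ↑T → u ∉ T → v ∉ T →
      C4Hitting G ↑((T \ {x 0, x 1, x 2, x 3}) ∪ {u, v}) ∧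
        ((T \ {x 0, x 1, x 2, x 3}) ∪ {u, v}).card < T.card := by
    refine fun T hT huT hvT => ⟨?_, hT.card_sdiff_union_lt huv huT hvT hadj hcard⟩
    have := hT.sdiff_union fun y hy => (hX y hy).subset
    simpa only [Finset.coe_union, Finset.coe_sdiff, Finset.coe_insert, Finset.coe_singleton]
      using this
  refine ⟨main S hS hu hv, fun M hM hmin => ?_⟩
  by_contra! h
  obtain ⟨hM', hlt⟩ := main M hM h.1 h.2
  exact (hmin (M \ {x 0, x 1, x 2, x 3} ∪ {u, v}) (by simpa using hM')).not_gt hlt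
end

section
/- There is an absolute constant C such that the following holds. For every CNF formula φ and every path decomposition of φ of width p, there exists a 3-CNF formula ψ of size at most C times the size of φ, together with a path decomposition of ψ of width at most p + 2, such that ψ is satisfiable if and only if φ is satisfiable. -/
open scoped Classical

namespace PPSETH

theorem mem_cnfVars {φ : CNF} {x : Var} : x ∈ cnfVars φ ↔ ∃ c ∈ φ, x ∈ clauseVars c := by
  induction φ with
  | nil => simp [cnfVars]
  | cons c φ ih =>
    have h : cnfVars (c :: φ) = clauseVars c ∪ cnfVars φ := rfl
    simp [h, ih]

theorem card_cnfVars_le (φ : CNF) : (cnfVars φ).card ≤ (φ.map Finset.card).sum := by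
  induction φ with
  | nil => simp [cnfVars]
  | cons c φ ih =>
    have h : cnfVars (c :: φ) = clauseVars c ∪ cnfVars φ := rfl
    have h₁ := Finset.card_union_le (clauseVars c) (cnfVars φ)
    have h₂ : (clauseVars c).card ≤ c.card := Finset.card_image_le
    simp only [h, List.map_cons, List.sum_cons]
    omega

/-- The `i`-th literal of a clause, in an arbitrary fixed order. -/
noncomputable def lit (c : Clause) (i : ℕ) : Var × Bool := c.toList.getD i (0, true)

theorem lit_mem {c : Clause} {i : ℕ} (h : i < c.card) : lit c i ∈ c := by
  have h' : i < c.toList.length := by simpa using h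
  rw [← Finset.mem_toList, lit, List.getD_eq_getElem _ _ h']
  exact List.getElem_mem h'

theorem exists_lit {c : Clause} {l : Var × Bool} (h : l ∈ c) : ∃ i < c.card, lit c i = l := by
  rw [← Finset.mem_toList] at h
  obtain ⟨i, hi, rfl⟩ := List.getElem_of_mem h
  exact ⟨i, by simpa using hi, List.getD_eq_getElem _ _ hi⟩

/-- The link clause of a chain: `x_a ∧ ¬ l` implies `x_{a+1}`. -/
def link (a : Var) (l : Var × Bool) : Clause := {(a, false), l, (a + 1, true)}

/-- The 3-CNF chain replacing the clause `c`, with the auxiliary variables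
`a, a + 1, …, a + c.card`. -/
noncomputable def chain (a : Var) (c : Clause) : CNF :=
  {(a, true)} :: {(a + c.card, false)} ::
    (List.range c.card).map fun i => link (a + i) (lit c i)

theorem mem_chain {a : Var} {c d : Clause} :
    d ∈ chain a c ↔ d = {(a, true)} ∨ d = {(a + c.card, false)} ∨
      ∃ i < c.card, d = link (a + i) (lit c i) := by
  simp [chain, eq_comm]

theorem card_link_le (a : Var) (l : Var × Bool) : (link a l).card ≤ 3 := Finset.card_le_three

theorem clauseVars_link (a : Var) (l : Var × Bool) :
    clauseVars (link a l) = {a, l.1, a + 1} := by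
  simp [clauseVars, link, Finset.image_insert]

theorem satC_link {τ : Var → Bool} {a : Var} {l : Var × Bool} :
    SatC τ (link a l) ↔ τ a = false ∨ τ l.1 = l.2 ∨ τ (a + 1) = true := by
  simp [SatC, link]

theorem isKCNF_chain (a : Var) (c : Clause) : IsKCNF 3 (chain a c) := by
  intro d hd
  obtain rfl | rfl | ⟨i, -, rfl⟩ := mem_chain.1 hd
  · simp
  · simp
  · exact card_link_le _ _

theorem sum_card_chain_le (a : Var) (c : Clause) :
    ((chain a c).map Finset.card).sum ≤ 2 + 3 * c.card := by
  have h := List.sum_le_card_nsmul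
    ((List.range c.card).map fun i => (link (a + i) (lit c i)).card) 3
    (by
      intro x hx
      obtain ⟨i, -, rfl⟩ := List.mem_map.1 hx
      exact card_link_le _ _)
  simp only [List.length_map, List.length_range, smul_eq_mul] at h
  simp only [chain, List.map_cons, List.map_map, List.sum_cons, Finset.card_singleton,
    Function.comp_def]
  omega

theorem satC_of_sat_chain {τ : Var → Bool} {a : Var} {c : Clause} (h : Sat τ (chain a c)) :
    SatC τ c := by
  by_contra hc
  have key : ∀ i ≤ c.card, τ (a + i) = true := by
    intro i
    induction i with
    | zero =>
      intro _
      simpa [SatC] using h _ (mem_chain.2 (Or.inl rfl))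
    | succ i ih =>
      intro hi
      have h₁ := satC_link.1 (h _ (mem_chain.2 (Or.inr (Or.inr ⟨i, hi, rfl⟩))))
      rw [ih (by omega)] at h₁
      obtain h₁ | h₁ | h₁ := h₁
      · simp at h₁
      · exact absurd ⟨_, lit_mem hi, h₁⟩ hc
      · exact h₁
  have h₂ := h _ (mem_chain.2 (Or.inr (Or.inl rfl)))
  simp [SatC, key _ le_rfl] at h₂

theorem sat_chain {τ : Var → Bool} {a : Var} {c : Clause} (hc : SatC τ c)
    (haux : ∀ i ≤ c.card, τ (a + i) = true ↔ ∀ i' < i, τ (lit c i').1 ≠ (lit c i').2) :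
    Sat τ (chain a c) := by
  intro d hd
  obtain rfl | rfl | ⟨i, hi, rfl⟩ := mem_chain.1 hd
  · simpa [SatC] using haux 0 (Nat.zero_le _)
  · obtain ⟨l, hl, hτ⟩ := hc
    obtain ⟨i, hi, rfl⟩ := exists_lit hl
    have h : ¬ τ (a + c.card) = true := fun h => (haux _ le_rfl).1 h i hi hτ
    simpa [SatC] using h
  · rw [satC_link]
    by_contra! hcon
    obtain ⟨h₁, h₂, h₃⟩ := hcon
    refine h₃ ((haux (i + 1) hi).2 fun i' hi' => ?_)
    obtain h | rfl := Nat.lt_succ_iff_lt_or_eq.1 hi'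
    · exact (haux i hi.le).1 (by simpa using h₁) i' h
    · exact h₂

/-- The conjunction of the chains of the clauses of `φ`, the `j`-th one starting at the auxiliary
variable `a j`. -/
noncomputable def chains (a : ℕ → Var) (φ : CNF) : CNF :=
  (List.range φ.length).flatMap fun j => chain (a j) (φ.getD j ∅)

theorem mem_chains {a : ℕ → Var} {φ : CNF} {d : Clause} :
    d ∈ chains a φ ↔ ∃ j < φ.length, d ∈ chain (a j) (φ.getD j ∅) := by
  simp only [chains, List.mem_flatMap, List.mem_range]

theorem getD_mem {α : Type*} {L : List α} {j : ℕ} (hj : j < L.length) (d : α) :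
    L.getD j d ∈ L := by
  rw [List.getD_eq_getElem _ _ hj]
  exact List.getElem_mem hj

theorem exists_getD_eq {α : Type*} {L : List α} {b : α} (hb : b ∈ L) (d : α) :
    ∃ j < L.length, L.getD j d = b := by
  obtain ⟨j, hj, rfl⟩ := List.getElem_of_mem hb
  exact ⟨j, hj, List.getD_eq_getElem _ _ hj⟩

theorem map_getD_range {α : Type*} (L : List α) (d : α) :
    ((List.range L.length).map fun j => L.getD j d) = L := by
  apply List.ext_getElem
  · simp
  · intro i h₁ h₂
    simp [List.getElem?_eq_getElem h₂]

theorem cnfVars_subset_chains (a : ℕ → Var) (φ : CNF) : cnfVars φ ⊆ cnfVars (chains a φ) := by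
  intro x hx
  obtain ⟨c, hc, hx⟩ := mem_cnfVars.1 hx
  obtain ⟨j, hj, rfl⟩ := exists_getD_eq hc ∅
  obtain ⟨l, hl, rfl⟩ := Finset.mem_image.1 hx
  obtain ⟨i, hi, rfl⟩ := exists_lit hl
  refine mem_cnfVars.2
    ⟨_, mem_chains.2 ⟨j, hj, mem_chain.2 (Or.inr (Or.inr ⟨i, hi, rfl⟩))⟩, ?_⟩
  simp [clauseVars_link]

theorem size_chains_le (a : ℕ → Var) {φ : CNF} (hφ : ∅ ∉ φ) :
    size (chains a φ) ≤ 10 * size φ := by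
  have h₁ : ((chains a φ).map Finset.card).sum ≤ 5 * (φ.map Finset.card).sum := by
    conv_rhs => rw [← map_getD_range φ ∅]
    rw [chains, List.flatMap, List.map_flatten, List.sum_flatten, List.map_map, List.map_map,
      List.map_map, ← List.sum_map_mul_left]
    refine List.sum_le_sum fun j hj => ?_
    have hj : j < φ.length := List.mem_range.1 hj
    have hpos : 0 < (φ.getD j ∅).card :=
      Finset.card_pos.2 (Finset.nonempty_iff_ne_empty.2 fun h => hφ (h ▸ getD_mem hj ∅))
    have := sum_card_chain_le (a j) (φ.getD j ∅)
    simp only [Function.comp_apply]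
    omega
  have h₂ := card_cnfVars_le (chains a φ)
  simp only [size]
  omega

theorem getD_map_range {α : Type*} (f : ℕ → α) (T n : ℕ) (d : α) :
    ((List.range T).map f).getD n d = if n < T then f n else d := by
  split_ifs with h
  · simp [List.getD_eq_getElem?_getD, h]
  · simp [List.getD_eq_getElem?_getD, h]

/-- A path decomposition in which every bag of `B` is repeated `M` times, and the auxiliary
variables `N + n` and `N + n + 1` are added to the `n`-th bag if they lie in `V`. -/
def stretch (B : List (Finset Var)) (N M : ℕ) (V : Finset Var) : List (Finset Var) :=
  (List.range (B.length * M)).map fun n => B.getD (n / M) ∅ ∪ ({N + n, N + n + 1} ∩ V)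

theorem mem_stretch_getD {B : List (Finset Var)} {N M : ℕ} {V : Finset Var} {n x : ℕ} :
    x ∈ (stretch B N M V).getD n ∅ ↔ n < B.length * M ∧
      (x ∈ B.getD (n / M) ∅ ∨ (x = N + n ∨ x = N + n + 1) ∧ x ∈ V) := by
  rw [stretch, getD_map_range]
  split_ifs with h <;> simp [h]

/-- The first auxiliary variable of the chain of the `j`-th clause, which is placed at the
`g j`-th bag, when there are `m` clauses and `K` bounds the lengths of the chains. -/
def start (N m K : ℕ) (g : ℕ → ℕ) (j : ℕ) : ℕ := N + (g j * (m * K) + j * K)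

theorem offset_lt {m K j i : ℕ} (hj : j < m) (hi : i < K) : j * K + i < m * K := by
  nlinarith

theorem pd_stretch {φ : CNF} {p : ℕ} {B : List (Finset Var)} (hB : PD φ p B) {N K : ℕ}
    {g : ℕ → ℕ} (hN : ∀ x ∈ cnfVars φ, x < N) (hK : ∀ c ∈ φ, c.card < K)
    (hg : ∀ j < φ.length, g j < B.length ∧ clauseVars (φ.getD j ∅) ⊆ B.getD (g j) ∅) :
    PD (chains (start N φ.length K g) φ) (p + 2)
      (stretch B N (φ.length * K) (cnfVars (chains (start N φ.length K g) φ))) := by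
  set ψ := chains (start N φ.length K g) φ
  obtain ⟨⟨hsub, -, -, hint⟩, hcard⟩ := hB
  have hsub' : ∀ n, B.getD n ∅ ⊆ cnfVars φ := by
    intro n
    by_cases h : n < B.length
    · exact hsub _ (getD_mem h ∅)
    · simp [List.getD_eq_getElem?_getD, h]
  have hcover : ∀ d ∈ ψ, ∃ b ∈ stretch B N (φ.length * K) (cnfVars ψ), clauseVars d ⊆ b := by
    intro d hd
    have hdV : clauseVars d ⊆ cnfVars ψ := fun x hx => mem_cnfVars.2 ⟨d, hd, hx⟩
    obtain ⟨j, hj, hdj⟩ := mem_chains.1 hd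
    obtain ⟨hgj, hcj⟩ := hg j hj
    have hk := hK _ (getD_mem hj ∅)
    suffices h : ∃ i < K, ∀ x : ℕ, x ∈ clauseVars d → x ∈ clauseVars (φ.getD j ∅) ∨
        x = start N φ.length K g j + i ∨ x = start N φ.length K g j + i + 1 by
      obtain ⟨i, hi, h⟩ := h
      have hlt := offset_lt hj hi
      have hdiv : (g j * (φ.length * K) + j * K + i) / (φ.length * K) = g j := by
        rw [add_assoc, mul_comm, Nat.mul_add_div (by omega), Nat.div_eq_of_lt hlt, add_zero]
      have hT : g j * (φ.length * K) + j * K + i < B.length * (φ.length * K) := by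
        rw [add_assoc]
        exact offset_lt hgj hlt
      refine ⟨(stretch B N (φ.length * K) (cnfVars ψ)).getD
        (g j * (φ.length * K) + j * K + i) ∅, getD_mem (by simpa [stretch] using hT) _, ?_⟩
      intro x hx
      refine mem_stretch_getD.2 ⟨hT, ?_⟩
      rw [hdiv]
      obtain h | h := h x hx
      · exact Or.inl (hcj h)
      · refine Or.inr ⟨?_, hdV hx⟩
        simp only [start] at h
        omega
    obtain rfl | rfl | ⟨i, hi, rfl⟩ := mem_chain.1 hdj
    · exact ⟨0, by omega, by simp [clauseVars]⟩
    · exact ⟨_, hk, by simp [clauseVars]⟩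
    · refine ⟨i, by omega, fun x hx => ?_⟩
      simp only [clauseVars_link, Finset.mem_insert, Finset.mem_singleton] at hx
      obtain h | rfl | h := hx
      · exact Or.inr (Or.inl h)
      · exact Or.inl (Finset.mem_image_of_mem _ (lit_mem hi))
      · exact Or.inr (Or.inr h)
  refine ⟨⟨?_, ?_, hcover, ?_⟩, ?_⟩
  · intro b hb
    obtain ⟨n, -, rfl⟩ := List.mem_map.1 hb
    exact Finset.union_subset ((hsub' _).trans (cnfVars_subset_chains _ _))
      Finset.inter_subset_right
  · intro x hx
    obtain ⟨d, hd, hx⟩ := mem_cnfVars.1 hx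
    obtain ⟨b, hb, hdb⟩ := hcover d hd
    exact ⟨b, hb, hdb hx⟩
  · intro (x : ℕ) i j k hij hjk hi hk
    rw [mem_stretch_getD] at hi hk ⊢
    have hN' : ∀ n, x ∈ B.getD n ∅ → x < N := fun n hn => hN x (hsub' n hn)
    refine ⟨by omega, ?_⟩
    obtain ⟨-, hi | ⟨hi, hxV⟩⟩ := hi <;> obtain ⟨-, hk | ⟨hk, -⟩⟩ := hk
    · exact Or.inl (hint x _ _ _ (Nat.div_le_div_right hij) (Nat.div_le_div_right hjk) hi hk)
    · have := hN' _ hi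
      omega
    · have := hN' _ hk
      omega
    · exact Or.inr ⟨by omega, hxV⟩
  · intro b hb
    obtain ⟨n, hn, rfl⟩ := List.mem_map.1 hb
    have hlt : n / (φ.length * K) < B.length :=
      Nat.div_lt_of_lt_mul (by rw [mul_comm]; exact List.mem_range.1 hn)
    have h₁ := hcard _ (getD_mem hlt ∅)
    have h₂ : ({N + n, N + n + 1} ∩ cnfVars ψ).card ≤ 2 :=
      (Finset.card_le_card Finset.inter_subset_left).trans Finset.card_le_two
    have h₃ := Finset.card_union_le (B.getD (n / (φ.length * K)) ∅)
      ({N + n, N + n + 1} ∩ cnfVars ψ)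
    omega

theorem satisfiable_chains_iff {φ : CNF} {N K : ℕ} (g : ℕ → ℕ)
    (hN : ∀ x ∈ cnfVars φ, x < N) (hK : ∀ c ∈ φ, c.card < K) :
    Satisfiable (chains (start N φ.length K g) φ) ↔ Satisfiable φ := by
  constructor
  · rintro ⟨τ, hτ⟩
    refine ⟨τ, fun c hc => ?_⟩
    obtain ⟨j, hj, rfl⟩ := exists_getD_eq hc ∅
    exact satC_of_sat_chain fun d hd => hτ d (mem_chains.2 ⟨j, hj, hd⟩)
  · rintro ⟨τ, hτ⟩
    let blocked : ℕ → Prop := fun q => ∀ i' < q % K,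
      τ (lit (φ.getD (q % (φ.length * K) / K) ∅) i').1 ≠
        (lit (φ.getD (q % (φ.length * K) / K) ∅) i').2
    let σ : Var → Bool := fun x => if x < N then τ x else decide (blocked (x - N))
    refine ⟨σ, fun d hd => ?_⟩
    obtain ⟨j, hj, hd⟩ := mem_chains.1 hd
    have hc := getD_mem hj ∅
    have hσ : ∀ l ∈ φ.getD j ∅, σ l.1 = τ l.1 := fun l hl =>
      if_pos (hN _ (mem_cnfVars.2 ⟨_, hc, Finset.mem_image_of_mem _ hl⟩))
    refine sat_chain ?_ ?_ d hd
    · obtain ⟨l, hl, h⟩ := hτ _ hc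
      exact ⟨l, hl, (hσ l hl).trans h⟩
    · intro i hi
      have hiK : i < K := hi.trans_lt (hK _ hc)
      have hlt := offset_lt hj hiK
      have hmod : (g j * (φ.length * K) + (j * K + i)) % (φ.length * K) = j * K + i := by
        rw [Nat.mul_add_mod_self_right, Nat.mod_eq_of_lt hlt]
      have hdiv : (j * K + i) / K = j := by
        rw [mul_comm, Nat.mul_add_div (by omega), Nat.div_eq_of_lt hiK, add_zero]
      have hmod' : (g j * (φ.length * K) + (j * K + i)) % K = i := by
        rw [← mul_assoc, Nat.mul_add_mod_self_right, Nat.mul_add_mod_self_right,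
          Nat.mod_eq_of_lt hiK]
      have hx : start N φ.length K g j + i = N + (g j * (φ.length * K) + (j * K + i)) := by
        simp only [start]
        omega
      have hσx : σ (start N φ.length K g j + i) =
          decide (blocked (g j * (φ.length * K) + (j * K + i))) := by
        rw [hx]
        simp [σ]
      rw [hσx, decide_eq_true_iff]
      simp only [blocked, hmod, hmod', hdiv]
      refine forall₂_congr fun i' hi' => ?_
      rw [hσ _ (lit_mem (hi'.trans_le hi))]

/-- There is an absolute constant `C` such that: from every CNF formula
`φ` and path decomposition of `φ` of width `p`, one can obtain a 3-CNF formula `ψ` of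
size at most `C` times the size of `φ`, with a path decomposition of width at most
`p + 2`, such that `ψ` is satisfiable iff `φ` is. -/
theorem stmt7 : ∃ C : ℕ, ∀ (φ : CNF) (p : ℕ) (B : List (Finset Var)),
    PD φ p B →
    ∃ (ψ : CNF) (B' : List (Finset Var)),
      IsKCNF 3 ψ ∧
      size ψ ≤ C * size φ ∧
      PD ψ (p + 2) B' ∧
      (Satisfiable ψ ↔ Satisfiable φ) := by
  refine ⟨10, fun φ p B hB => ?_⟩
  by_cases hφ : ∅ ∈ φ
  · refine ⟨[∅], [∅], by simp [IsKCNF], by simp [size, cnfVars, clauseVars], ⟨⟨?_, ?_, ?_, ?_⟩, ?_⟩,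
      ?_⟩
    · simp
    · simp [cnfVars, clauseVars]
    · simp [clauseVars]
    · rintro x (_ | i) j k - - hx <;> simp at hx
    · simp
    · constructor
      · rintro ⟨τ, hτ⟩
        simpa [SatC] using hτ ∅ (by simp)
      · rintro ⟨τ, hτ⟩
        simpa [SatC] using hτ ∅ hφ
  · have hg : ∀ j, ∃ b, j < φ.length →
        b < B.length ∧ clauseVars (φ.getD j ∅) ⊆ B.getD b ∅ := by
      intro j
      by_cases hj : j < φ.length
      · obtain ⟨b, hb, hsub⟩ := hB.1.2.2.1 _ (getD_mem hj ∅)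
        obtain ⟨n, hn, rfl⟩ := exists_getD_eq hb ∅
        exact ⟨n, fun _ => ⟨hn, hsub⟩⟩
      · exact ⟨0, fun h => absurd h hj⟩
    choose g hg using hg
    have hN : ∀ x ∈ cnfVars φ, x < (cnfVars φ).sup id + 1 := fun x hx =>
      Nat.lt_succ_of_le (Finset.le_sup (f := id) hx)
    have hK : ∀ c ∈ φ, c.card < (φ.map Finset.card).sum + 1 := fun c hc =>
      Nat.lt_succ_of_le (List.le_sum_of_mem (List.mem_map_of_mem hc))
    refine ⟨_, _, ?_, size_chains_le _ hφ, pd_stretch hB hN hK hg,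
      satisfiable_chains_iff g hN hK⟩
    intro d hd
    obtain ⟨j, -, hd⟩ := mem_chains.1 hd
    exact isKCNF_chain _ _ d hd

end PPSETH
end

section
/- Let φ be a 3-CNF formula with m clauses in which every clause consists of exactly 3 literals on 3 distinct variables and in which every variable occurs at most r times. Then there exists a 2-CNF formula ψ, given as a list of exactly 10m clauses each containing at most 2 literals (clauses counted with multiplicity), in which every variable occurs at most 4r times, such that φ is satisfiable if and only if ψ admits a Boolean assignment satisfying at least 7m of its clauses (counted with multiplicity). Moreover, for every path decomposition of φ of width p there exists a path decomposition of ψ of width at most p + 1. -/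
open scoped Classical

namespace PPSETH

abbrev Lit := Var × Bool

/-- The complementary literal. -/
def Lit.neg (l : Lit) : Lit := (l.1, !l.2)

/-- The clause formed by three literals. -/
noncomputable def tripleClause (t : Lit × Lit × Lit) : Clause := {t.1, t.2.1, t.2.2}

/-- The literals of the triple are on three distinct variables. -/
def DistinctVars (t : Lit × Lit × Lit) : Prop :=
  t.1.1 ≠ t.2.1.1 ∧ t.1.1 ≠ t.2.2.1 ∧ t.2.1.1 ≠ t.2.2.1

/-- The Garey–Johnson–Stockmeyer gadget replacing a 3-clause, with auxiliary variable `d`. -/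
noncomputable def gadget (t : Lit × Lit × Lit) (d : Var) : CNF :=
  [{t.1}, {t.2.1}, {t.2.2}, {(d, true)},
    {t.1.neg, t.2.1.neg}, {t.2.1.neg, t.2.2.neg}, {t.1.neg, t.2.2.neg},
    {t.1, (d, false)}, {t.2.1, (d, false)}, {t.2.2, (d, false)}]

/-- Replace every triple by its gadget, using the auxiliary variables `N, N + 1, …`. -/
noncomputable def gadgets : ℕ → List (Lit × Lit × Lit) → CNF
  | _, [] => []
  | N, t :: ts => gadget t N ++ gadgets (N + 1) ts

theorem mem_clauseVars {c : Clause} {x : Var} : x ∈ clauseVars c ↔ ∃ l ∈ c, l.1 = x := by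
  simp [clauseVars]

theorem mem_clauseVars_triple {t : Lit × Lit × Lit} {x : Var} :
    x ∈ clauseVars (tripleClause t) ↔ x = t.1.1 ∨ x = t.2.1.1 ∨ x = t.2.2.1 := by
  simp only [mem_clauseVars, tripleClause, Finset.mem_insert, Finset.mem_singleton,
    exists_eq_or_imp, exists_eq_left, eq_comm]

theorem clauseVars_subset_cnfVars {φ : CNF} {c : Clause} (hc : c ∈ φ) :
    clauseVars c ⊆ cnfVars φ := fun _ hx => mem_cnfVars.2 ⟨c, hc, hx⟩

theorem satCount_append (φ ψ : CNF) (τ : Var → Bool) :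
    satCount (φ ++ ψ) τ = satCount φ τ + satCount ψ τ := by
  simp [satCount]

theorem occs_append (φ ψ : CNF) (x : Var) : occs (φ ++ ψ) x = occs φ x + occs ψ x := by
  simp [occs]

theorem occs_cons (c : Clause) (φ : CNF) (x : Var) :
    occs (c :: φ) x = (if x ∈ clauseVars c then 1 else 0) + occs φ x := by
  simp [occs]

theorem occs_eq_zero {φ : CNF} {x : Var} (h : x ∉ cnfVars φ) : occs φ x = 0 := by
  simp only [mem_cnfVars, not_exists, not_and] at h
  simp only [occs, List.sum_eq_zero_iff, List.mem_map]
  rintro _ ⟨c, hc, rfl⟩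
  simp [h c hc]

theorem exists_triple {c : Clause} (h : c.card = 3) (hv : (clauseVars c).card = 3) :
    ∃ t, tripleClause t = c ∧ DistinctVars t := by
  obtain ⟨x, y, z, hxy, hxz, hyz, rfl⟩ := Finset.card_eq_three.1 h
  refine ⟨(x, y, z), by ext; simp [tripleClause], ?_⟩
  have hi : Set.InjOn Prod.fst (({x, y, z} : Finset Lit) : Set Lit) := by
    apply Finset.card_image_iff.1
    rw [h, ← hv]
    rfl
  refine ⟨fun e => hxy ?_, fun e => hxz ?_, fun e => hyz ?_⟩ <;>
    exact hi (by simp) (by simp) e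

theorem exists_triples {φ : CNF} (h : ∀ c ∈ φ, c.card = 3 ∧ (clauseVars c).card = 3) :
    ∃ ts : List (Lit × Lit × Lit), ts.map tripleClause = φ ∧ ∀ t ∈ ts, DistinctVars t := by
  induction φ with
  | nil => exact ⟨[], by simp⟩
  | cons c φ ih =>
    obtain ⟨ts, rfl, hts⟩ := ih fun c' hc' => h c' (List.mem_cons_of_mem _ hc')
    obtain ⟨t, rfl, ht⟩ := exists_triple (h c List.mem_cons_self).1 (h c List.mem_cons_self).2
    refine ⟨t :: ts, by simp, fun t' ht' => ?_⟩
    rcases List.mem_cons.1 ht' with rfl | h'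
    exacts [ht, hts _ h']

theorem length_gadgets (N : ℕ) (ts : List (Lit × Lit × Lit)) :
    (gadgets N ts).length = 10 * ts.length := by
  induction ts generalizing N with
  | nil => rfl
  | cons t ts ih =>
    rw [gadgets, List.length_append, ih, List.length_cons]
    simp only [gadget, List.length_cons, List.length_nil]
    ring

theorem isKCNF_gadgets (N : ℕ) (ts : List (Lit × Lit × Lit)) : IsKCNF 2 (gadgets N ts) := by
  induction ts generalizing N with
  | nil => simp [IsKCNF, gadgets]
  | cons t ts ih =>
    intro c hc
    rcases List.mem_append.1 hc with h | h
    · simp only [gadget, List.mem_cons, List.not_mem_nil, or_false] at h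
      rcases h with rfl | rfl | rfl | rfl | rfl | rfl | rfl | rfl | rfl | rfl <;>
        first | exact Finset.card_le_two | simp
    · exact ih _ c h

theorem satC_singleton {τ : Var → Bool} {a : Lit} : SatC τ {a} ↔ τ a.1 = a.2 := by
  simp [SatC]

theorem satC_pair {τ : Var → Bool} {a b : Lit} :
    SatC τ {a, b} ↔ τ a.1 = a.2 ∨ τ b.1 = b.2 := by
  simp [SatC]

theorem satC_tripleClause {τ : Var → Bool} {t : Lit × Lit × Lit} :
    SatC τ (tripleClause t) ↔ τ t.1.1 = t.1.2 ∨ τ t.2.1.1 = t.2.1.2 ∨ τ t.2.2.1 = t.2.2.2 := by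
  simp [SatC, tripleClause]

theorem satisfies_neg {τ : Var → Bool} {a : Lit} : τ a.neg.1 = a.neg.2 ↔ ¬ τ a.1 = a.2 := by
  simp only [Lit.neg]
  cases τ a.1 <;> cases a.2 <;> simp

theorem satCount_gadget_le (t : Lit × Lit × Lit) (d : Var) (τ : Var → Bool) :
    satCount (gadget t d) τ ≤ 7 := by
  simp only [satCount, gadget, List.map_cons, List.map_nil, List.sum_cons, List.sum_nil,
    satC_singleton, satC_pair, satisfies_neg]
  by_cases h₁ : τ t.1.1 = t.1.2 <;> by_cases h₂ : τ t.2.1.1 = t.2.1.2 <;>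
    by_cases h₃ : τ t.2.2.1 = t.2.2.2 <;> cases h₄ : τ d <;> simp [h₁, h₂, h₃]

theorem satC_of_satCount_gadget {t : Lit × Lit × Lit} {d : Var} {τ : Var → Bool}
    (h : 7 ≤ satCount (gadget t d) τ) : SatC τ (tripleClause t) := by
  rw [satC_tripleClause]
  contrapose! h
  obtain ⟨h₁, h₂, h₃⟩ := h
  simp only [satCount, gadget, List.map_cons, List.map_nil, List.sum_cons, List.sum_nil,
    satC_singleton, satC_pair, satisfies_neg]
  cases h₄ : τ d <;> simp [h₁, h₂, h₃]

theorem satCount_gadget_of_satC {t : Lit × Lit × Lit} {d : Var} {τ : Var → Bool}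
    (h : SatC τ (tripleClause t))
    (hd : τ d = true ↔ τ t.1.1 = t.1.2 ∧ τ t.2.1.1 = t.2.1.2 ∧ τ t.2.2.1 = t.2.2.2) :
    satCount (gadget t d) τ = 7 := by
  rw [satC_tripleClause] at h
  simp only [satCount, gadget, List.map_cons, List.map_nil, List.sum_cons, List.sum_nil,
    satC_singleton, satC_pair, satisfies_neg]
  by_cases h₁ : τ t.1.1 = t.1.2 <;> by_cases h₂ : τ t.2.1.1 = t.2.1.2 <;>
    by_cases h₃ : τ t.2.2.1 = t.2.2.2 <;> cases h₄ : τ d <;> simp_all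

theorem satCount_gadgets_le (N : ℕ) (ts : List (Lit × Lit × Lit)) (τ : Var → Bool) :
    satCount (gadgets N ts) τ ≤ 7 * ts.length := by
  induction ts generalizing N with
  | nil => simp [gadgets, satCount]
  | cons t ts ih =>
    have h₁ := ih (N + 1)
    have h₂ := satCount_gadget_le t N τ
    rw [gadgets, satCount_append, List.length_cons]
    omega

theorem sat_of_satCount_gadgets {N : ℕ} {ts : List (Lit × Lit × Lit)} {τ : Var → Bool}
    (h : 7 * ts.length ≤ satCount (gadgets N ts) τ) : Sat τ (ts.map tripleClause) := by
  induction ts generalizing N with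
  | nil => simp [Sat]
  | cons t ts ih =>
    have h₁ := satCount_gadgets_le (N + 1) ts τ
    have h₂ := satCount_gadget_le t N τ
    rw [gadgets, satCount_append, List.length_cons] at h
    intro c hc
    rcases List.mem_cons.1 hc with rfl | hc
    · exact satC_of_satCount_gadget (d := N) (by omega)
    · exact ih (N := N + 1) (by omega) c hc

theorem satC_congr {c : Clause} {τ τ' : Var → Bool} (h : ∀ x ∈ clauseVars c, τ x = τ' x)
    (hc : SatC τ c) : SatC τ' c := by
  obtain ⟨l, hl, e⟩ := hc
  exact ⟨l, hl, by rw [← h _ (mem_clauseVars.2 ⟨l, hl, rfl⟩), e]⟩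

theorem exists_satCount_gadgets {N : ℕ} {ts : List (Lit × Lit × Lit)} {τ : Var → Bool}
    (hN : ∀ t ∈ ts, ∀ x ∈ clauseVars (tripleClause t), x < N)
    (h : Sat τ (ts.map tripleClause)) :
    ∃ τ' : Var → Bool, (∀ x < N, τ' x = τ x) ∧ 7 * ts.length ≤ satCount (gadgets N ts) τ' := by
  induction ts generalizing N τ with
  | nil => exact ⟨τ, by simp⟩
  | cons t ts ih =>
    have ht := hN t List.mem_cons_self
    set v : Bool := decide (τ t.1.1 = t.1.2 ∧ τ t.2.1.1 = t.2.1.2 ∧ τ t.2.2.1 = t.2.2.2) with hv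
    have hup : ∀ x < N, Function.update τ N v x = τ x := fun x hx =>
      Function.update_of_ne hx.ne _ _
    obtain ⟨τ', hτ', hc⟩ := ih (N := N + 1) (τ := Function.update τ N v)
      (fun t' ht' x hx => (hN t' (List.mem_cons_of_mem _ ht') x hx).trans (Nat.lt_succ_self N))
      (by
        intro c hc
        refine satC_congr (fun x hx => ?_) (h c (List.mem_cons_of_mem _ hc))
        obtain ⟨t', ht', rfl⟩ := List.mem_map.1 hc
        exact (hup x (hN t' (List.mem_cons_of_mem _ ht') x hx)).symm)
    have hag : ∀ x < N, τ' x = τ x := fun x hx => by rw [hτ' x (by omega), hup x hx]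
    refine ⟨τ', hag, ?_⟩
    have hg : satCount (gadget t N) τ' = 7 := by
      apply satCount_gadget_of_satC
      · exact satC_congr (fun x hx => (hag x (ht x hx)).symm) (h _ List.mem_cons_self)
      · rw [hτ' N (by omega), Function.update_self, hv, decide_eq_true_iff,
          hag _ (ht _ (mem_clauseVars_triple.2 (Or.inl rfl))),
          hag _ (ht _ (mem_clauseVars_triple.2 (Or.inr (Or.inl rfl)))),
          hag _ (ht _ (mem_clauseVars_triple.2 (Or.inr (Or.inr rfl))))]
    rw [gadgets, satCount_append, hg, List.length_cons]
    omega

theorem mem_clauseVars_singleton {a : Lit} {x : Var} : x ∈ clauseVars {a} ↔ x = a.1 := by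
  simp [mem_clauseVars, eq_comm]

theorem mem_clauseVars_pair {a b : Lit} {x : Var} :
    x ∈ clauseVars {a, b} ↔ x = a.1 ∨ x = b.1 := by
  simp [clauseVars]

theorem occs_gadget_le {t : Lit × Lit × Lit} (ht : DistinctVars t) (d x : ℕ)
    (hd : d ∉ clauseVars (tripleClause t)) :
    occs (gadget t d) x ≤
      4 * (if x ∈ clauseVars (tripleClause t) then 1 else 0) + if x = d then 4 else 0 := by
  obtain ⟨h₁, h₂, h₃⟩ := ht
  simp only [mem_clauseVars_triple, not_or] at hd
  obtain ⟨d₁, d₂, d₃⟩ := hd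
  simp only [occs, gadget, List.map_cons, List.map_nil, List.sum_cons, List.sum_nil,
    mem_clauseVars_singleton, mem_clauseVars_pair, mem_clauseVars_triple, Lit.neg]
  by_cases e₁ : x = t.1.1
  · subst e₁
    simp [h₁, h₂, Ne.symm d₁]
  by_cases e₂ : x = t.2.1.1
  · subst e₂
    simp [h₃, Ne.symm h₁, Ne.symm d₂]
  by_cases e₃ : x = t.2.2.1
  · subst e₃
    simp [Ne.symm h₂, Ne.symm h₃, Ne.symm d₃]
  by_cases e₄ : x = d <;> simp [e₁, e₂, e₃, e₄, d₁, d₂, d₃]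

theorem occs_gadgets_le {N : ℕ} {ts : List (Lit × Lit × Lit)} (hd : ∀ t ∈ ts, DistinctVars t)
    (hN : ∀ t ∈ ts, ∀ x ∈ clauseVars (tripleClause t), x < N) (x : ℕ) :
    occs (gadgets N ts) x ≤
      4 * occs (ts.map tripleClause) x + if N ≤ x ∧ x < N + ts.length then 4 else 0 := by
  induction ts generalizing N with
  | nil => simp [gadgets, occs]
  | cons t ts ih =>
    have h₁ := ih (N := N + 1) (fun t' ht' => hd t' (List.mem_cons_of_mem _ ht'))
      (fun t' ht' x hx => (hN t' (List.mem_cons_of_mem _ ht') x hx).trans (Nat.lt_succ_self N))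
    have h₂ := occs_gadget_le (hd t List.mem_cons_self) N x
      (fun h => lt_irrefl _ (hN t List.mem_cons_self N h))
    rw [gadgets, occs_append, List.map_cons, occs_cons, List.length_cons]
    split_ifs at * <;> omega

theorem clauseVars_gadget_subset {t : Lit × Lit × Lit} {d : Var} {c : Clause}
    (hc : c ∈ gadget t d) : clauseVars c ⊆ insert d (clauseVars (tripleClause t)) := by
  intro x hx
  rw [Finset.mem_insert, mem_clauseVars_triple]
  simp only [gadget, List.mem_cons, List.not_mem_nil, or_false] at hc
  rcases hc with rfl | rfl | rfl | rfl | rfl | rfl | rfl | rfl | rfl | rfl <;>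
    simp only [mem_clauseVars_singleton, mem_clauseVars_pair, Lit.neg] at hx <;> tauto

theorem cnfVars_subset_gadgets (N : ℕ) (ts : List (Lit × Lit × Lit)) :
    cnfVars (ts.map tripleClause) ∪ Finset.Ico N (N + ts.length) ⊆ cnfVars (gadgets N ts) := by
  induction ts generalizing N with
  | nil => simp [cnfVars]
  | cons t ts ih =>
    have hg : ∀ c ∈ gadget t N, ∀ x ∈ clauseVars c, x ∈ cnfVars (gadgets N (t :: ts)) :=
      fun c hc x hx => mem_cnfVars.2 ⟨c, List.mem_append_left _ hc, hx⟩
    have hr : ∀ x, x ∈ cnfVars (gadgets (N + 1) ts) → x ∈ cnfVars (gadgets N (t :: ts)) := by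
      intro x hx
      obtain ⟨c, hc, hx⟩ := mem_cnfVars.1 hx
      exact mem_cnfVars.2 ⟨c, List.mem_append_right _ hc, hx⟩
    intro x hx
    rcases Finset.mem_union.1 hx with hx | hx
    · obtain ⟨c, hc, hx⟩ := mem_cnfVars.1 hx
      rcases List.mem_cons.1 hc with rfl | hc
      · rcases mem_clauseVars_triple.1 hx with h | h | h
        · exact hg {t.1} (by simp [gadget]) x (mem_clauseVars_singleton.2 h)
        · exact hg {t.2.1} (by simp [gadget]) x (mem_clauseVars_singleton.2 h)
        · exact hg {t.2.2} (by simp [gadget]) x (mem_clauseVars_singleton.2 h)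
      · exact hr x (ih _ (Finset.mem_union_left _ (mem_cnfVars.2 ⟨c, hc, hx⟩)))
    · rw [Finset.mem_Ico (α := ℕ), List.length_cons] at hx
      rcases eq_or_ne (α := ℕ) x N with rfl | hne
      · exact hg {(x, true)} (by simp [gadget]) x (mem_clauseVars_singleton.2 rfl)
      · exact hr x (ih _ (Finset.mem_union_right _ ((Finset.mem_Ico (α := ℕ)).2 (by omega))))

/-- The bags containing any given variable are consecutive. -/
def Consecutive (B : List (Finset Var)) : Prop :=
  ∀ x : Var, ∀ i j k : ℕ, i ≤ j → j ≤ k →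
    x ∈ B.getD i ∅ → x ∈ B.getD k ∅ → x ∈ B.getD j ∅

theorem Consecutive.insert_bag {L₁ L₂ : List (Finset Var)} {b : Finset Var} {d : Var}
    (h : Consecutive (L₁ ++ b :: L₂)) (hd : ∀ b' ∈ L₁ ++ b :: L₂, d ∉ b') :
    Consecutive (L₁ ++ b :: insert d b :: L₂) := by
  have hd' : ∀ i, d ∉ (L₁ ++ b :: L₂).getD i ∅ := by
    intro i
    rcases lt_or_ge i (L₁ ++ b :: L₂).length with hi | hi
    · rw [List.getD_eq_getElem _ _ hi]
      exact hd _ (List.getElem_mem hi)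
    · rw [List.getD_eq_default _ _ hi]
      simp
  have key : ∀ x i, x ∈ (L₁ ++ b :: insert d b :: L₂).getD i ∅ ↔
      x ∈ (L₁ ++ b :: L₂).getD (if i ≤ L₁.length then i else i - 1) ∅ ∨
        (x = d ∧ i = L₁.length + 1) := by
    intro x i
    rcases lt_or_ge i L₁.length with hi | hi
    · rw [if_pos hi.le, List.getD_append _ _ _ _ hi, List.getD_append _ _ _ _ hi]
      have : i ≠ L₁.length + 1 := by omega
      simp [this]
    · obtain ⟨n, rfl⟩ := Nat.exists_eq_add_of_le hi
      rw [List.getD_append_right _ _ _ _ hi]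
      rcases n with _ | _ | n
      · simp
      · simp [or_comm]
      · rw [if_neg (by omega), List.getD_append_right _ _ _ _ (by omega)]
        have e : L₁.length + (n + 1 + 1) - 1 - L₁.length = n + 1 := by omega
        have e' : L₁.length + (n + 1 + 1) - L₁.length = n + 2 := by omega
        rw [e, e']
        simp
  intro x i j k hij hjk hi hk
  rw [key] at hi hk ⊢
  rcases eq_or_ne x d with rfl | hx
  · simp only [hd', false_or, true_and] at hi hk ⊢
    omega
  · simp only [hx, false_and, or_false] at hi hk ⊢
    exact h x _ _ _ (by split_ifs <;> omega) (by split_ifs <;> omega) hi hk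

theorem exists_bags_gadgets {p N : ℕ} {ts : List (Lit × Lit × Lit)} {B : List (Finset Var)}
    {S : Finset Var} (hS : ∀ x ∈ S, x < N) (hBS : ∀ b ∈ B, b ⊆ S)
    (hcard : ∀ b ∈ B, b.card ≤ p + 1)
    (hcov : ∀ t ∈ ts, ∃ b ∈ B, clauseVars (tripleClause t) ⊆ b) (hB : Consecutive B) :
    ∃ B' : List (Finset Var), B ⊆ B' ∧ (∀ b ∈ B', b ⊆ S ∪ Finset.Ico N (N + ts.length)) ∧
      (∀ b ∈ B', b.card ≤ p + 1 + 1) ∧ (∀ c ∈ gadgets N ts, ∃ b ∈ B', clauseVars c ⊆ b) ∧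
      Consecutive B' := by
  induction ts generalizing N with
  | nil =>
    exact ⟨B, List.Subset.refl B, fun b hb => (hBS b hb).trans Finset.subset_union_left,
      fun b hb => (hcard b hb).trans (Nat.le_succ _), by simp [gadgets], hB⟩
  | cons t ts ih =>
    obtain ⟨B₁, hsub, hvars, hcard₁, hcov₁, hB₁⟩ := ih (N := N + 1)
      (fun x hx => (hS x hx).trans (Nat.lt_succ_self N))
      (fun t' ht' => hcov t' (List.mem_cons_of_mem _ ht'))
    obtain ⟨b, hb, htb⟩ := hcov t List.mem_cons_self
    obtain ⟨L₁, L₂, rfl⟩ := List.append_of_mem (hsub hb)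
    have hfresh : ∀ b' ∈ L₁ ++ b :: L₂, N ∉ b' := by
      intro b' hb' hN
      rcases Finset.mem_union.1 (hvars b' hb' hN) with h | h
      · exact lt_irrefl _ (hS N h)
      · have := ((Finset.mem_Ico (α := ℕ)).1 h).1
        omega
    have hmem : ∀ b', b' ∈ L₁ ++ b :: insert N b :: L₂ ↔
        b' ∈ L₁ ++ b :: L₂ ∨ b' = insert N b := by
      intro b'
      simp only [List.mem_append, List.mem_cons]
      tauto
    have hvars' : ∀ b' ∈ L₁ ++ b :: L₂, b' ⊆ S ∪ Finset.Ico N (N + (t :: ts).length) := by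
      intro b' hb'
      refine (hvars b' hb').trans (Finset.union_subset_union_right fun x hx => ?_)
      rw [Finset.mem_Ico (α := ℕ)] at hx
      rw [Finset.mem_Ico (α := ℕ), List.length_cons]
      omega
    refine ⟨L₁ ++ b :: insert N b :: L₂, fun b' hb' => (hmem b').2 (Or.inl (hsub hb')),
      fun b' hb' => ?_, fun b' hb' => ?_, fun c hc => ?_, hB₁.insert_bag hfresh⟩
    · rcases (hmem b').1 hb' with h | rfl
      · exact hvars' b' h
      · refine Finset.insert_subset (Finset.mem_union_right _ ?_) (hvars' b (hsub hb))
        rw [Finset.mem_Ico (α := ℕ), List.length_cons]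
        omega
    · rcases (hmem b').1 hb' with h | rfl
      · exact hcard₁ b' h
      · exact (Finset.card_insert_le _ _).trans (Nat.succ_le_succ (hcard b hb))
    · rcases List.mem_append.1 hc with hc | hc
      · exact ⟨insert N b, (hmem _).2 (Or.inr rfl),
          (clauseVars_gadget_subset hc).trans (Finset.insert_subset_insert N htb)⟩
      · obtain ⟨b', hb', h⟩ := hcov₁ c hc
        exact ⟨b', (hmem _).2 (Or.inl hb'), h⟩

/-- Let `φ` be a 3-CNF formula with `m` clauses, each clause consisting of
exactly 3 literals on 3 distinct variables, in which every variable occurs at most `r`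
times.  Then there is a 2-CNF formula `ψ` with exactly `10·m` clauses (with multiplicity),
in which every variable occurs at most `4·r` times, such that `φ` is satisfiable iff `ψ`
has an assignment satisfying at least `7·m` of its clauses (with multiplicity); and every
path decomposition of `φ` of width `p` yields one of `ψ` of width at most `p + 1`. -/
theorem stmt9 (φ : CNF) (m r : ℕ) (hm : φ.length = m)
    (hcl : ∀ c ∈ φ, c.card = 3 ∧ (clauseVars c).card = 3)
    (hocc : ∀ x : Var, occs φ x ≤ r) :
    ∃ ψ : CNF,
      ψ.length = 10 * m ∧
      IsKCNF 2 ψ ∧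
      (∀ x : Var, occs ψ x ≤ 4 * r) ∧
      (Satisfiable φ ↔ ∃ τ, 7 * m ≤ satCount ψ τ) ∧
      (∀ (p : ℕ) (B : List (Finset Var)), PD φ p B →
        ∃ B' : List (Finset Var), PD ψ (p + 1) B') := by
  obtain ⟨ts, rfl, hts⟩ := exists_triples hcl
  obtain ⟨N, hN⟩ : ∃ N, ∀ x ∈ cnfVars (ts.map tripleClause), x < N :=
    ⟨(cnfVars (ts.map tripleClause)).sup id + 1, fun x hx =>
      Nat.lt_succ_of_le (Finset.le_sup (f := id) hx)⟩
  have hN' : ∀ t ∈ ts, ∀ x ∈ clauseVars (tripleClause t), x < N := fun t ht x hx =>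
    hN x (clauseVars_subset_cnfVars (List.mem_map_of_mem ht) hx)
  rw [List.length_map] at hm
  subst hm
  refine ⟨gadgets N ts, length_gadgets N ts, isKCNF_gadgets N ts, fun (x : ℕ) => ?_, ⟨?_, ?_⟩, ?_⟩
  · have h := occs_gadgets_le hts hN' x
    have hx := hocc x
    split_ifs at h with hc
    · have h₀ := occs_eq_zero fun hx => hc.1.not_gt (hN x hx)
      obtain ⟨t, ts', rfl⟩ := List.exists_cons_of_length_pos (l := ts) (by omega)
      have hr := hocc t.1.1
      rw [List.map_cons, occs_cons, if_pos (mem_clauseVars_triple.2 (Or.inl rfl))] at hr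
      omega
    · omega
  · rintro ⟨τ, hτ⟩
    obtain ⟨τ', -, h⟩ := exists_satCount_gadgets hN' hτ
    exact ⟨τ', h⟩
  · rintro ⟨τ, hτ⟩
    exact ⟨τ, sat_of_satCount_gadgets hτ⟩
  · rintro p B ⟨⟨hsub, -, hcov, hcons⟩, hcard⟩
    obtain ⟨B', -, hvars, hcard', hcov', hcons'⟩ := exists_bags_gadgets hN hsub hcard
      (fun t ht => hcov _ (List.mem_map_of_mem ht)) hcons
    refine ⟨B', ⟨fun b hb => (hvars b hb).trans (cnfVars_subset_gadgets N ts), ?_, hcov',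
      hcons'⟩, hcard'⟩
    intro x hx
    obtain ⟨c, hc, hxc⟩ := mem_cnfVars.1 hx
    obtain ⟨b, hb, h⟩ := hcov' c hc
    exact ⟨b, hb, h hxc⟩

end PPSETH
end

section
/- There is an absolute constant C such that the following holds. For every integer k ≥ 2, every simple graph G on n ≥ 1 vertices, and every path decomposition of G of width p, there exists a CNF formula φ with at most (n + k + 2)^C variables and clauses, together with a path decomposition of φ of width at most (p + 2)·⌈log₂ k⌉, such that φ is satisfiable if and only if G admits a proper k-coloring, i.e., an assignment of one of k colors to each vertex such that adjacent vertices receive distinct colors. -/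
open scoped Classical

namespace PPSETH

/-- A path decomposition of a simple graph of width `p`: a list of bags of vertices, each
of size at most `p + 1`, covering every vertex, containing both endpoints of every edge
in some bag, with each vertex occurring in an interval of bags. -/
def GraphPD {V : Type*} (G : SimpleGraph V) (p : ℕ) (Bs : List (Finset V)) : Prop :=
  (∀ b ∈ Bs, b.card ≤ p + 1) ∧
  (∀ v : V, ∃ b ∈ Bs, v ∈ b) ∧
  (∀ u v : V, G.Adj u v → ∃ b ∈ Bs, u ∈ b ∧ v ∈ b) ∧
  (∀ v : V, ∀ i j k : ℕ, i ≤ j → j ≤ k →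
    v ∈ Bs.getD i ∅ → v ∈ Bs.getD k ∅ → v ∈ Bs.getD j ∅)

section Coloring

variable {V : Type} {d : ℕ}

/-- The clause stating that the bits of vertex `v` do not spell the code `a`. -/
def avoid (x : V × Fin d ↪ Var) (v : V) (a : Fin d → Bool) : Clause :=
  Finset.univ.image fun i => (x (v, i), !a i)

theorem satC_avoid (x : V × Fin d ↪ Var) (v : V) (a : Fin d → Bool) (τ : Var → Bool) :
    SatC τ (avoid x v a) ↔ (fun i => τ (x (v, i))) ≠ a := by
  simp [SatC, avoid, Function.ne_iff, Bool.eq_not]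

theorem satC_union (τ : Var → Bool) (c₁ c₂ : Clause) :
    SatC τ (c₁ ∪ c₂) ↔ SatC τ c₁ ∨ SatC τ c₂ := by
  simp only [SatC, Finset.mem_union, or_and_right, exists_or]

theorem clauseVars_union (c₁ c₂ : Clause) :
    clauseVars (c₁ ∪ c₂) = clauseVars c₁ ∪ clauseVars c₂ :=
  Finset.image_union _ _

/-- The variables encoding the colors of the vertices in `b`. -/
def bitVars (x : V × Fin d ↪ Var) (b : Finset V) : Finset Var :=
  (b ×ˢ Finset.univ).map x

theorem mem_bitVars {x : V × Fin d ↪ Var} {b : Finset V} {y : Var} :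
    y ∈ bitVars x b ↔ ∃ v ∈ b, ∃ i, x (v, i) = y := by
  simp [bitVars]

theorem card_bitVars (x : V × Fin d ↪ Var) (b : Finset V) :
    (bitVars x b).card = b.card * d := by
  simp [bitVars]

theorem clauseVars_avoid_subset (x : V × Fin d ↪ Var) {v : V} (a : Fin d → Bool)
    {b : Finset V} (hv : v ∈ b) : clauseVars (avoid x v a) ⊆ bitVars x b := by
  intro y hy
  simp only [clauseVars, avoid, Finset.mem_image, Finset.mem_univ, true_and] at hy
  obtain ⟨_, ⟨i, rfl⟩, rfl⟩ := hy
  exact mem_bitVars.2 ⟨v, hv, i, rfl⟩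

variable [Fintype V] {k : ℕ}

/-- The clauses stating that every vertex spells a code in the range of `g` and that adjacent
vertices spell distinct codes. -/
noncomputable def colorClauses (G : SimpleGraph V) (x : V × Fin d ↪ Var)
    (g : Fin k ↪ (Fin d → Bool)) : Finset Clause :=
  ((Finset.univ : Finset (V × (Fin d → Bool))).filter fun q => q.2 ∉ Set.range g).image
      (fun q => avoid x q.1 q.2) ∪
    ((Finset.univ : Finset (V × V × (Fin d → Bool))).filter fun q => G.Adj q.1 q.2.1).image
      (fun q => avoid x q.1 q.2.2 ∪ avoid x q.2.1 q.2.2)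

theorem mem_colorClauses {G : SimpleGraph V} {x : V × Fin d ↪ Var}
    {g : Fin k ↪ (Fin d → Bool)} {c : Clause} :
    c ∈ colorClauses G x g ↔ (∃ v a, a ∉ Set.range g ∧ avoid x v a = c) ∨
      ∃ u v a, G.Adj u v ∧ avoid x u a ∪ avoid x v a = c := by
  simp only [colorClauses, Finset.mem_union, Finset.mem_image, Finset.mem_filter,
    Finset.mem_univ, true_and, Prod.exists]

theorem card_colorClauses_le (G : SimpleGraph V) (x : V × Fin d ↪ Var)
    (g : Fin k ↪ (Fin d → Bool)) :
    (colorClauses G x g).card ≤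
      Fintype.card V * 2 ^ d + Fintype.card V * (Fintype.card V * 2 ^ d) := by
  refine (Finset.card_union_le _ _).trans (add_le_add ?_ ?_) <;>
  · refine Finset.card_image_le.trans ((Finset.card_filter_le _ _).trans ?_)
    simp

theorem satisfiable_colorClauses_iff (G : SimpleGraph V) (x : V × Fin d ↪ Var)
    (g : Fin k ↪ (Fin d → Bool)) :
    Satisfiable (colorClauses G x g).toList ↔ G.Colorable k := by
  constructor
  · rintro ⟨τ, hτ⟩
    have hrange : ∀ v, ∃ j, g j = fun i => τ (x (v, i)) := by
      intro v
      by_contra h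
      exact (satC_avoid x v _ τ).1
        (hτ _ (Finset.mem_toList.2 (mem_colorClauses.2 (Or.inl ⟨v, _, h, rfl⟩)))) rfl
    choose col hcol using hrange
    refine ⟨SimpleGraph.Coloring.mk col ?_⟩
    intro u v huv heq
    have h := hτ _ (Finset.mem_toList.2
      (mem_colorClauses.2 (Or.inr ⟨u, v, g (col u), huv, rfl⟩)))
    rw [satC_union, satC_avoid, satC_avoid] at h
    rcases h with h | h
    · exact h (hcol u).symm
    · exact h (by rw [heq, hcol v])
  · rintro ⟨col⟩
    let τ : Var → Bool := Function.extend x (fun q => g (col q.1) q.2) fun _ => false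
    have hτ : ∀ v, (fun i => τ (x (v, i))) = g (col v) := fun v =>
      funext fun i => x.injective.extend_apply _ _ _
    refine ⟨τ, fun c hc => ?_⟩
    rcases mem_colorClauses.1 (Finset.mem_toList.1 hc) with
      ⟨v, a, ha, rfl⟩ | ⟨u, v, a, huv, rfl⟩
    · rw [satC_avoid, hτ]
      exact fun h => ha ⟨_, h⟩
    · rw [satC_union, satC_avoid, satC_avoid, hτ, hτ]
      by_contra! h
      exact col.valid huv (g.injective (h.1.trans h.2.symm))

theorem cnfVars_colorClauses_subset (G : SimpleGraph V) (x : V × Fin d ↪ Var)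
    (g : Fin k ↪ (Fin d → Bool)) :
    cnfVars (colorClauses G x g).toList ⊆ bitVars x Finset.univ := by
  intro y hy
  obtain ⟨c, hc, hyc⟩ := mem_cnfVars.1 hy
  rcases mem_colorClauses.1 (Finset.mem_toList.1 hc) with
    ⟨v, a, -, rfl⟩ | ⟨u, v, a, -, rfl⟩
  · exact clauseVars_avoid_subset x a (Finset.mem_univ _) hyc
  · rw [clauseVars_union] at hyc
    exact Finset.union_subset (clauseVars_avoid_subset x a (Finset.mem_univ _))
      (clauseVars_avoid_subset x a (Finset.mem_univ _)) hyc

theorem pd_colorClauses {G : SimpleGraph V} {p : ℕ} {Bs : List (Finset V)}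
    (hB : GraphPD G p Bs) (x : V × Fin d ↪ Var) (g : Fin k ↪ (Fin d → Bool)) :
    PD (colorClauses G x g).toList ((p + 2) * d)
      (Bs.map fun b => bitVars x b ∩ cnfVars (colorClauses G x g).toList) := by
  obtain ⟨hcard, hvert, hedge, hint⟩ := hB
  set φ := (colorClauses G x g).toList with hφ
  have hclause : ∀ c ∈ φ, ∃ b ∈ Bs, clauseVars c ⊆ bitVars x b ∩ cnfVars φ := by
    intro c hc
    have hsub : clauseVars c ⊆ cnfVars φ := fun y hy => mem_cnfVars.2 ⟨c, hc, hy⟩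
    rcases mem_colorClauses.1 (Finset.mem_toList.1 hc) with
      ⟨v, a, -, rfl⟩ | ⟨u, v, a, huv, rfl⟩
    · obtain ⟨b, hb, hv⟩ := hvert v
      exact ⟨b, hb, Finset.subset_inter (clauseVars_avoid_subset x a hv) hsub⟩
    · obtain ⟨b, hb, hu, hv⟩ := hedge u v huv
      refine ⟨b, hb, Finset.subset_inter ?_ hsub⟩
      rw [clauseVars_union]
      exact Finset.union_subset (clauseVars_avoid_subset x a hu) (clauseVars_avoid_subset x a hv)
  have hmem : ∀ y i, y ∈ (Bs.map fun b => bitVars x b ∩ cnfVars φ).getD i ∅ ↔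
      y ∈ bitVars x (Bs.getD i ∅) ∧ y ∈ cnfVars φ := by
    intro y i
    have h0 : (∅ : Finset Var) = (fun b => bitVars x b ∩ cnfVars φ) ∅ := by simp [bitVars]
    rw [h0, List.getD_map, Finset.mem_inter]
  refine ⟨⟨?_, ?_, ?_, ?_⟩, ?_⟩
  · intro b' hb'
    obtain ⟨b, -, rfl⟩ := List.mem_map.1 hb'
    exact Finset.inter_subset_right
  · intro y hy
    obtain ⟨c, hc, hyc⟩ := mem_cnfVars.1 hy
    obtain ⟨b, hb, hsub⟩ := hclause c hc
    exact ⟨_, List.mem_map_of_mem hb, hsub hyc⟩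
  · intro c hc
    obtain ⟨b, hb, hsub⟩ := hclause c hc
    exact ⟨_, List.mem_map_of_mem hb, hsub⟩
  · intro y i j l hij hjl hi hl
    obtain ⟨hi, hy⟩ := (hmem y i).1 hi
    obtain ⟨v, hvi, s, rfl⟩ := mem_bitVars.1 hi
    obtain ⟨w, hwl, t, hwt⟩ := mem_bitVars.1 ((hmem _ l).1 hl).1
    obtain ⟨rfl, rfl⟩ := Prod.mk.inj (x.injective hwt)
    exact (hmem _ j).2 ⟨mem_bitVars.2 ⟨w, hint w i j l hij hjl hvi hwl, _, rfl⟩, hy⟩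
  · intro b' hb'
    obtain ⟨b, hb, rfl⟩ := List.mem_map.1 hb'
    calc _ ≤ (bitVars x b).card := Finset.card_le_card Finset.inter_subset_left
      _ = b.card * d := card_bitVars x b
      _ ≤ (p + 2) * d := Nat.mul_le_mul_right _ ((hcard b hb).trans (by omega))
      _ ≤ (p + 2) * d + 1 := Nat.le_succ _

end Coloring

/-- There is an absolute constant `C` such that: for every `k ≥ 2`,
every simple graph `G` on `n ≥ 1` vertices and every path decomposition of `G` of width
`p`, there is a CNF formula `φ` with at most `(n + k + 2)^C` variables and clauses,
together with a path decomposition of width at most `(p + 2)·⌈log₂ k⌉`, such that `φ` is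
satisfiable iff `G` is properly `k`-colorable. -/
theorem stmt13 : ∃ C : ℕ, ∀ (k : ℕ) (V : Type) [Fintype V] [DecidableEq V],
    ∀ (G : SimpleGraph V) (p : ℕ) (Bs : List (Finset V)),
    2 ≤ k → 1 ≤ Fintype.card V → GraphPD G p Bs →
    ∃ (φ : CNF) (B' : List (Finset Var)),
      (cnfVars φ).card ≤ (Fintype.card V + k + 2) ^ C ∧
      φ.length ≤ (Fintype.card V + k + 2) ^ C ∧
      PD φ ((p + 2) * Nat.clog 2 k) B' ∧
      (Satisfiable φ ↔ G.Colorable k) := by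
  refine ⟨4, fun k V _ _ G p Bs hk hV hB => ?_⟩
  have hk2 : k ≤ 2 ^ Nat.clog 2 k := Nat.le_pow_clog one_lt_two k
  have h2k : 2 ^ Nat.clog 2 k ≤ 2 * k := by
    have hpos : 0 < Nat.clog 2 k := Nat.clog_pos one_lt_two hk
    have hlt := Nat.pow_pred_clog_lt_self one_lt_two hk
    rw [← Nat.succ_pred_eq_of_pos hpos, pow_succ]
    omega
  have hdk : Nat.clog 2 k ≤ 2 * k := Nat.lt_two_pow_self.le.trans h2k
  generalize Nat.clog 2 k = d at *
  obtain ⟨g⟩ : Nonempty (Fin k ↪ (Fin d → Bool)) :=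
    Function.Embedding.nonempty_of_card_le (by simpa using hk2)
  let x : V × Fin d ↪ Var := (Fintype.equivFin (V × Fin d)).toEmbedding.trans Fin.valEmbedding
  refine ⟨_, _, ?_, ?_, pd_colorClauses hB x g, satisfiable_colorClauses_iff G x g⟩
  · have h := Finset.card_le_card (cnfVars_colorClauses_subset G x g)
    rw [card_bitVars, Finset.card_univ] at h
    refine h.trans ((Nat.mul_le_mul_left _ hdk).trans ?_)
    generalize Fintype.card V = n
    calc n * (2 * k) ≤ (n + k + 2) ^ 2 := by nlinarith
      _ ≤ (n + k + 2) ^ 4 := Nat.pow_le_pow_right (by omega) (by omega)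
  · rw [Finset.length_toList]
    refine (card_colorClauses_le G x g).trans ?_
    generalize Fintype.card V = n
    calc n * 2 ^ d + n * (n * 2 ^ d) ≤ n * (2 * k) + n * (n * (2 * k)) := by gcongr
      _ = (n + 1) * (2 * (n * k)) := by ring
      _ ≤ (n + k + 2) ^ 2 * (n + k + 2) ^ 2 := Nat.mul_le_mul (by nlinarith) (by nlinarith)
      _ = (n + k + 2) ^ 4 := by ring

end PPSETH
end
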